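/- Let A be a 3-homogeneous supersolvable line arrangement in ℙ² which is not a pencil, with d = |A|. Then either d = 6 and A is projectively equivalent to the full monomial arrangement A(1,1,3): xyz(x−y)(y−z)(x−z) = 0, which has n₂ = 3, or d = 5 and A is projectively equivalent to the arrangement B: xyz(x−y)(x−z) = 0, which has n₂ = 4. In both cases n₂ ≥ d/2. -/

import Mathlib

open scoped LinearAlgebra.Projectivization

noncomputable section

attribute [local instance] Classical.propDecidable

/-- A point of the complex projective plane. -/
abbrev ProjPoint := ℙ ℂ (Fin 3 → ℂ)

/-- A line of the complex projective plane, encoded by a defining linear form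
up to scalar, i.e. as a point of the dual projective plane. -/
abbrev ProjLine := ℙ ℂ (Module.Dual ℂ (Fin 3 → ℂ))

/-- The incidence relation between points and lines of `ℙ²`. -/
def PointOnLine (p : ProjPoint) (L : ProjLine) : Prop :=
  L.rep p.rep = 0

/-- The multiplicity of a point with respect to a line arrangement:
the number of lines of the arrangement passing through the point. -/
def mult (A : Finset ProjLine) (p : ProjPoint) : ℕ :=
  Set.ncard {L : ProjLine | L ∈ A ∧ PointOnLine p L}

/-- An intersection point of a line arrangement: a point lying on at least two lines. -/
def IsIntersectionPoint (A : Finset ProjLine) (p : ProjPoint) : Prop :=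
  2 ≤ mult A p

/-- A modular point: an intersection point `p` such that for any other intersection
point `q`, the line through `p` and `q` belongs to the arrangement. -/
def IsModular (A : Finset ProjLine) (p : ProjPoint) : Prop :=
  IsIntersectionPoint A p ∧
    ∀ q : ProjPoint, IsIntersectionPoint A q → q ≠ p →
      ∃ L ∈ A, PointOnLine p L ∧ PointOnLine q L

/-- A supersolvable line arrangement: one possessing a modular point. -/
def IsSupersolvable (A : Finset ProjLine) : Prop :=
  ∃ p, IsModular A p

/-- An `m`-homogeneous supersolvable line arrangement: supersolvable, and all
modular points have multiplicity `m`. -/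
def IsHomogSS (A : Finset ProjLine) (m : ℕ) : Prop :=
  IsSupersolvable A ∧ ∀ p, IsModular A p → mult A p = m

/-- `nk A k` is the number of intersection points of multiplicity `k` of `A`. -/
def nk (A : Finset ProjLine) (k : ℕ) : ℕ :=
  Set.ncard {p : ProjPoint | IsIntersectionPoint A p ∧ mult A p = k}

/-- A pencil: all lines pass through a common point. -/
def IsPencil (A : Finset ProjLine) : Prop :=
  ∃ p, ∀ L ∈ A, PointOnLine p L

/-- The linear form `a x + b y + c z` on `ℂ³`. -/
def mkForm (a b c : ℂ) : Module.Dual ℂ (Fin 3 → ℂ) :=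
  a • LinearMap.proj 0 + b • LinearMap.proj 1 + c • LinearMap.proj 2

lemma mkForm_apply (a b c : ℂ) (v : Fin 3 → ℂ) :
    mkForm a b c v = a * v 0 + b * v 1 + c * v 2 := by
  simp [mkForm, smul_eq_mul]

lemma mkForm_ne_zero {a b c : ℂ} (h : a ≠ 0 ∨ b ≠ 0 ∨ c ≠ 0) :
    mkForm a b c ≠ 0 := by
  intro h0
  have h1 := congrArg (fun φ => φ (Pi.single 0 1)) h0
  have h2 := congrArg (fun φ => φ (Pi.single 1 1)) h0
  have h3 := congrArg (fun φ => φ (Pi.single 2 1)) h0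
  simp only [mkForm_apply] at h1 h2 h3
  simp [Pi.single_apply] at h1 h2 h3
  rcases h with h | h | h <;> simp_all

/-- The projective line with equation `a x + b y + c z = 0`. -/
def mkLine (a b c : ℂ) (h : a ≠ 0 ∨ b ≠ 0 ∨ c ≠ 0) : ProjLine :=
  Projectivization.mk ℂ (mkForm a b c) (mkForm_ne_zero h)

lemma vec_ne_zero {a b c : ℂ} (h : a ≠ 0 ∨ b ≠ 0 ∨ c ≠ 0) :
    (![a, b, c] : Fin 3 → ℂ) ≠ 0 := by
  intro h0
  have h1 := congrFun h0 0
  have h2 := congrFun h0 1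
  have h3 := congrFun h0 2
  rcases h with h | h | h <;> simp_all

/-- The projective point with homogeneous coordinates `(a : b : c)`. -/
def mkPoint (a b c : ℂ) (h : a ≠ 0 ∨ b ≠ 0 ∨ c ≠ 0) : ProjPoint :=
  Projectivization.mk ℂ ![a, b, c] (vec_ne_zero h)

/-- The full monomial line arrangement `A(m-2,1,3)`, defined by the equation
`xyz(x^{m-2}-y^{m-2})(y^{m-2}-z^{m-2})(x^{m-2}-z^{m-2}) = 0`: it consists of the three
coordinate lines together with the lines `x = ζ y`, `y = ζ z`, `x = ζ z` for `ζ`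
ranging over the `(m-2)`-nd roots of unity. -/
def monomialArr (m : ℕ) : Finset ProjLine :=
  {mkLine 1 0 0 (Or.inl one_ne_zero), mkLine 0 1 0 (Or.inr (Or.inl one_ne_zero)),
    mkLine 0 0 1 (Or.inr (Or.inr one_ne_zero))} ∪
  ((Polynomial.nthRoots (m - 2) (1 : ℂ)).toFinset.image fun ζ =>
    mkLine 1 (-ζ) 0 (Or.inl one_ne_zero)) ∪
  ((Polynomial.nthRoots (m - 2) (1 : ℂ)).toFinset.image fun ζ =>
    mkLine 0 1 (-ζ) (Or.inr (Or.inl one_ne_zero))) ∪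
  ((Polynomial.nthRoots (m - 2) (1 : ℂ)).toFinset.image fun ζ =>
    mkLine 1 0 (-ζ) (Or.inl one_ne_zero))

/-- The projective transformation of lines induced by a linear automorphism of `ℂ³`
(acting on defining linear forms through the inverse dual map). -/
def lineMap (T : (Fin 3 → ℂ) ≃ₗ[ℂ] (Fin 3 → ℂ)) : ProjLine → ProjLine :=
  Projectivization.map
    (T.symm.dualMap : Module.Dual ℂ (Fin 3 → ℂ) →ₗ[ℂ] Module.Dual ℂ (Fin 3 → ℂ))
    T.symm.dualMap.injective

/-- Two line arrangements are projectively equivalent if some projective linear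
transformation of `ℙ²` maps the set of lines of one onto the set of lines of the other. -/
def ProjEquiv (A B : Finset ProjLine) : Prop :=
  ∃ T : (Fin 3 → ℂ) ≃ₗ[ℂ] (Fin 3 → ℂ),
    (lineMap T) '' (↑A : Set ProjLine) = (↑B : Set ProjLine)

/-- The line arrangement `B : xyz(x-y)(x-z) = 0`. -/
def arrB : Finset ProjLine :=
  {mkLine 1 0 0 (Or.inl one_ne_zero), mkLine 0 1 0 (Or.inr (Or.inl one_ne_zero)),
    mkLine 0 0 1 (Or.inr (Or.inr one_ne_zero)),
    mkLine 1 (-1) 0 (Or.inl one_ne_zero), mkLine 1 0 (-1) (Or.inl one_ne_zero)}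

lemma pol_mk {v : Fin 3 → ℂ} (hv : v ≠ 0) {φ : Module.Dual ℂ (Fin 3 → ℂ)} (hφ : φ ≠ 0) :
    PointOnLine (Projectivization.mk ℂ v hv) (Projectivization.mk ℂ φ hφ) ↔ φ v = 0 := by
  unfold PointOnLine
  obtain ⟨a, ha⟩ := Projectivization.exists_smul_eq_mk_rep ℂ v hv
  obtain ⟨b, hb⟩ := Projectivization.exists_smul_eq_mk_rep ℂ φ hφ
  rw [← ha, ← hb]
  simp [Units.smul_def]

lemma pol_mkP {a b c u v w : ℂ} (h : a ≠ 0 ∨ b ≠ 0 ∨ c ≠ 0) (h' : u ≠ 0 ∨ v ≠ 0 ∨ w ≠ 0) :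
    PointOnLine (mkPoint a b c h) (mkLine u v w h') ↔ u * a + v * b + w * c = 0 := by
  unfold mkPoint mkLine
  rw [pol_mk, mkForm_apply]
  simp

lemma mkForm_surj (φ : Module.Dual ℂ (Fin 3 → ℂ)) :
    φ = mkForm (φ (Pi.single 0 1)) (φ (Pi.single 1 1)) (φ (Pi.single 2 1)) := by
  refine LinearMap.pi_ext' fun i => ?_
  ext
  fin_cases i <;> simp [mkForm_apply]

lemma exists_mkLine (L : ProjLine) : ∃ a b c h, L = mkLine a b c h := by
  induction L using Projectivization.ind with
  | h φ hφ =>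
    have h1 := mkForm_surj φ
    set a := φ (Pi.single 0 1)
    set b := φ (Pi.single 1 1)
    set c := φ (Pi.single 2 1)
    refine ⟨a, b, c, ?_, ?_⟩
    · by_contra! hc
      apply hφ
      rw [h1, hc.1, hc.2.1, hc.2.2]
      simp [mkForm]
    · unfold mkLine
      congr 1

lemma exists_mkPoint (p : ProjPoint) : ∃ a b c h, p = mkPoint a b c h := by
  induction p using Projectivization.ind with
  | h v hv =>
    refine ⟨v 0, v 1, v 2, ?_, ?_⟩
    · by_contra! hc
      apply hv
      ext i
      fin_cases i <;> simp [hc]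
    · unfold mkPoint
      congr 1
      ext i
      fin_cases i <;> simp

lemma vec_prop {a b c u v w : ℂ} (h : a ≠ 0 ∨ b ≠ 0 ∨ c ≠ 0) (h' : u ≠ 0 ∨ v ≠ 0 ∨ w ≠ 0) :
    (∃ t : ℂ, t * u = a ∧ t * v = b ∧ t * w = c) ↔
      (a * v = b * u ∧ a * w = c * u ∧ b * w = c * v) := by
  constructor
  · rintro ⟨t, rfl, rfl, rfl⟩
    refine ⟨by ring, by ring, by ring⟩
  · rintro ⟨h1, h2, h3⟩
    rcases h' with h' | h' | h'
    · refine ⟨a / u, ?_, ?_, ?_⟩ <;> field_simp <;> grind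
    · refine ⟨b / v, ?_, ?_, ?_⟩ <;> field_simp <;> grind
    · refine ⟨c / w, ?_, ?_, ?_⟩ <;> field_simp <;> grind

lemma mkPoint_eq {a b c u v w : ℂ} (h : a ≠ 0 ∨ b ≠ 0 ∨ c ≠ 0) (h' : u ≠ 0 ∨ v ≠ 0 ∨ w ≠ 0) :
    mkPoint a b c h = mkPoint u v w h' ↔
      (a * v = b * u ∧ a * w = c * u ∧ b * w = c * v) := by
  rw [← vec_prop h h']
  unfold mkPoint
  rw [Projectivization.mk_eq_mk_iff']
  refine exists_congr fun t => ?_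
  simp

lemma mkForm_inj {a b c u v w : ℂ} : mkForm a b c = mkForm u v w ↔ a = u ∧ b = v ∧ c = w := by
  constructor
  · intro h
    have h1 := congrArg (fun φ => φ (Pi.single 0 1)) h
    have h2 := congrArg (fun φ => φ (Pi.single 1 1)) h
    have h3 := congrArg (fun φ => φ (Pi.single 2 1)) h
    simp only [mkForm_apply] at h1 h2 h3
    simp at h1 h2 h3
    exact ⟨h1, h2, h3⟩
  · rintro ⟨rfl, rfl, rfl⟩; rfl

lemma mkLine_eq {a b c u v w : ℂ} (h : a ≠ 0 ∨ b ≠ 0 ∨ c ≠ 0) (h' : u ≠ 0 ∨ v ≠ 0 ∨ w ≠ 0) :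
    mkLine a b c h = mkLine u v w h' ↔
      (a * v = b * u ∧ a * w = c * u ∧ b * w = c * v) := by
  rw [← vec_prop h h']
  unfold mkLine
  rw [Projectivization.mk_eq_mk_iff']
  refine exists_congr fun t => ?_
  have : t • mkForm u v w = mkForm (t * u) (t * v) (t * w) := by
    simp [mkForm, smul_smul]
  rw [this, mkForm_inj]

/-- Two lines meet. -/
lemma exists_meet (L M : ProjLine) : ∃ p, PointOnLine p L ∧ PointOnLine p M := by
  obtain ⟨a, b, c, h, rfl⟩ := exists_mkLine L
  obtain ⟨u, v, w, h', rfl⟩ := exists_mkLine M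
  by_cases hz : b * w - c * v ≠ 0 ∨ c * u - a * w ≠ 0 ∨ a * v - b * u ≠ 0
  · refine ⟨mkPoint _ _ _ hz, ?_, ?_⟩ <;> rw [pol_mkP] <;> ring
  · push Not at hz
    have : mkLine a b c h = mkLine u v w h' := by
      rw [mkLine_eq]; grind
    rw [← this]
    simp only [and_self]
    by_cases ha : a = 0
    · exact ⟨mkPoint 1 0 0 (by simp), by rw [pol_mkP]; simp [ha]⟩
    · exact ⟨mkPoint (-b) a 0 (by simp [ha]), by rw [pol_mkP]; ring⟩

/-- Two distinct lines meet in only one point. -/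
lemma meet_unique {L M : ProjLine} (hLM : L ≠ M) {p q : ProjPoint}
    (h1 : PointOnLine p L) (h2 : PointOnLine p M) (h3 : PointOnLine q L)
    (h4 : PointOnLine q M) : p = q := by
  obtain ⟨a, b, c, h, rfl⟩ := exists_mkLine L
  obtain ⟨u, v, w, h', rfl⟩ := exists_mkLine M
  obtain ⟨x, y, z, hp, rfl⟩ := exists_mkPoint p
  obtain ⟨x', y', z', hq, rfl⟩ := exists_mkPoint q
  rw [pol_mkP] at h1 h2 h3 h4
  by_contra hne
  apply hLM
  rw [mkPoint_eq] at hne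
  rw [mkLine_eq]
  have e1 : ∀ t : ℂ, t * (x * y' - y * x') = 0 → t * (x * z' - z * x') = 0 →
      t * (y * z' - z * y') = 0 → t = 0 := by
    intro t k1 k2 k3
    by_contra ht
    apply hne
    simp only [mul_eq_zero, ht, false_or] at k1 k2 k3
    exact ⟨by linear_combination k1, by linear_combination k2, by linear_combination k3⟩
  refine ⟨?_, ?_, ?_⟩ <;> rw [← sub_eq_zero] <;> apply e1 <;> grind

def Conc (L M N : ProjLine) : Prop :=
  ∃ q, PointOnLine q L ∧ PointOnLine q M ∧ PointOnLine q N

lemma conc_det {a b c u v w x y z : ℂ} (h : a ≠ 0 ∨ b ≠ 0 ∨ c ≠ 0)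
    (h' : u ≠ 0 ∨ v ≠ 0 ∨ w ≠ 0) (h'' : x ≠ 0 ∨ y ≠ 0 ∨ z ≠ 0)
    (hc : Conc (mkLine a b c h) (mkLine u v w h') (mkLine x y z h'')) :
    a * (v * z - w * y) - b * (u * z - w * x) + c * (u * y - v * x) = 0 := by
  obtain ⟨q, h1, h2, h3⟩ := hc
  obtain ⟨r, s, t, hq, rfl⟩ := exists_mkPoint q
  rw [pol_mkP] at h1 h2 h3
  rcases hq with hq | hq | hq <;> refine mul_right_cancel₀ hq ?_ <;> grind

/-- The action on points. -/
def pointMap (T : (Fin 3 → ℂ) ≃ₗ[ℂ] (Fin 3 → ℂ)) : ProjPoint → ProjPoint :=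
  Projectivization.map (T : (Fin 3 → ℂ) →ₗ[ℂ] (Fin 3 → ℂ)) T.injective

lemma pol_map (T : (Fin 3 → ℂ) ≃ₗ[ℂ] (Fin 3 → ℂ)) (p : ProjPoint) (L : ProjLine) :
    PointOnLine (pointMap T p) (lineMap T L) ↔ PointOnLine p L := by
  induction p using Projectivization.ind with
  | h v hv =>
  induction L using Projectivization.ind with
  | h φ hφ =>
  unfold pointMap lineMap
  rw [Projectivization.map_mk, Projectivization.map_mk, pol_mk, pol_mk]
  simp

lemma lineMap_inj (T : (Fin 3 → ℂ) ≃ₗ[ℂ] (Fin 3 → ℂ)) : Function.Injective (lineMap T) :=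
  Projectivization.map_injective _ _

lemma pointMap_inj (T : (Fin 3 → ℂ) ≃ₗ[ℂ] (Fin 3 → ℂ)) : Function.Injective (pointMap T) :=
  Projectivization.map_injective _ _

lemma pointMap_surj (T : (Fin 3 → ℂ) ≃ₗ[ℂ] (Fin 3 → ℂ)) : Function.Surjective (pointMap T) := by
  intro p
  induction p using Projectivization.ind with
  | h v hv =>
  refine ⟨Projectivization.mk ℂ (T.symm v) (by simpa using hv), ?_⟩
  unfold pointMap
  rw [Projectivization.map_mk]
  simp

lemma conc_map (T : (Fin 3 → ℂ) ≃ₗ[ℂ] (Fin 3 → ℂ)) {L M N : ProjLine} (h : Conc L M N) :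
    Conc (lineMap T L) (lineMap T M) (lineMap T N) := by
  obtain ⟨q, h1, h2, h3⟩ := h
  exact ⟨pointMap T q, (pol_map T _ _).2 h1, (pol_map T _ _).2 h2, (pol_map T _ _).2 h3⟩

lemma nk_equiv {A B : Finset ProjLine} (h : ProjEquiv A B) (k : ℕ) : nk A k = nk B k := by
  obtain ⟨T, hT⟩ := h
  have hm : ∀ p, mult B (pointMap T p) = mult A p := by
    intro p
    unfold mult
    symm
    rw [← Set.ncard_image_of_injective _ (lineMap_inj T)]
    congr 1
    ext L
    simp only [Set.mem_ofPred_eq, Set.mem_image]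
    rw [← Finset.mem_coe (s := B), ← hT]
    symm
    constructor
    · rintro ⟨⟨M, hM, rfl⟩, h⟩
      exact ⟨M, ⟨hM, (pol_map T _ _).1 h⟩, rfl⟩
    · rintro ⟨M, ⟨hM, h⟩, rfl⟩
      exact ⟨⟨M, hM, rfl⟩, (pol_map T _ _).2 h⟩
  unfold nk
  rw [← Set.ncard_image_of_injective _ (pointMap_inj T)]
  congr 1
  ext p
  simp only [Set.mem_ofPred_eq, Set.mem_image, IsIntersectionPoint]
  obtain ⟨q, rfl⟩ := pointMap_surj T p
  rw [hm]
  constructor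
  · rintro ⟨r, hr, h⟩
    rwa [← pointMap_inj T h]
  · intro h
    exact ⟨q, h, rfl⟩

lemma mult_eq (A : Finset ProjLine) (p : ProjPoint) :
    mult A p = ∑ L ∈ A, if PointOnLine p L then 1 else 0 := by
  rw [← Finset.card_filter]
  unfold mult
  rw [← Set.ncard_coe_finset]
  congr 1
  ext L
  simp

lemma monomialArr_three : monomialArr 3 =
    {mkLine 1 0 0 (Or.inl one_ne_zero), mkLine 0 1 0 (Or.inr (Or.inl one_ne_zero)),
    mkLine 0 0 1 (Or.inr (Or.inr one_ne_zero)),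
    mkLine 1 (-1) 0 (Or.inl one_ne_zero), mkLine 1 0 (-1) (Or.inl one_ne_zero),
    mkLine 0 1 (-1) (Or.inr (Or.inl one_ne_zero))} := by
  have : (Polynomial.nthRoots (3 - 2) (1 : ℂ)).toFinset = {1} := by
    ext z
    simp [Polynomial.mem_nthRoots]
  unfold monomialArr
  rw [this]
  ext L
  simp only [Finset.image_singleton, Finset.mem_union, Finset.mem_insert, Finset.mem_singleton]
  tauto

lemma nk_arrB : nk arrB 2 = 4 := by
  have : {p : ProjPoint | IsIntersectionPoint arrB p ∧ mult arrB p = 2} =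
      (({mkPoint 1 0 0 (by simp), mkPoint 1 0 1 (by simp), mkPoint 1 1 0 (by simp),
        mkPoint 1 1 1 (by simp)} : Finset ProjPoint) : Set ProjPoint) := by
    ext p
    obtain ⟨a, b, c, h, rfl⟩ := exists_mkPoint p
    have hi : mult arrB (mkPoint a b c h) = (if a = 0 then 1 else 0) + ((if b = 0 then 1 else 0)
        + ((if c = 0 then 1 else 0) + ((if a = b then 1 else 0) + (if a = c then 1 else 0)))) := by
      rw [mult_eq, arrB]
      rw [Finset.sum_insert (by simp [mkLine_eq]), Finset.sum_insert (by simp [mkLine_eq]),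
        Finset.sum_insert (by simp [mkLine_eq]), Finset.sum_insert (by simp [mkLine_eq]),
        Finset.sum_singleton]
      simp only [pol_mkP]
      simp [← sub_eq_add_neg, sub_eq_zero]
    simp only [Set.mem_ofPred_eq, IsIntersectionPoint, hi, Finset.coe_insert, Finset.coe_singleton,
      Set.mem_insert_iff, Set.mem_singleton_iff, mkPoint_eq]
    by_cases h1 : a = 0 <;> by_cases h2 : b = 0 <;> by_cases h3 : c = 0 <;>
      by_cases h4 : a = b <;> by_cases h5 : a = c <;> simp_all <;> grind
  unfold nk
  rw [this, Set.ncard_coe_finset]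
  rw [Finset.card_insert_of_notMem (by simp [mkPoint_eq]),
    Finset.card_insert_of_notMem (by simp [mkPoint_eq]),
    Finset.card_insert_of_notMem (by simp [mkPoint_eq]), Finset.card_singleton]

lemma nk_mono : nk (monomialArr 3) 2 = 3 := by
  have : {p : ProjPoint | IsIntersectionPoint (monomialArr 3) p ∧ mult (monomialArr 3) p = 2} =
      (({mkPoint 0 1 1 (by simp), mkPoint 1 0 1 (by simp), mkPoint 1 1 0 (by simp)} :
        Finset ProjPoint) : Set ProjPoint) := by
    ext p
    obtain ⟨a, b, c, h, rfl⟩ := exists_mkPoint p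
    have hi : mult (monomialArr 3) (mkPoint a b c h) = (if a = 0 then 1 else 0) +
        ((if b = 0 then 1 else 0) + ((if c = 0 then 1 else 0) + ((if a = b then 1 else 0)
        + ((if a = c then 1 else 0) + (if b = c then 1 else 0))))) := by
      rw [mult_eq, monomialArr_three]
      rw [Finset.sum_insert (by simp [mkLine_eq]), Finset.sum_insert (by simp [mkLine_eq]),
        Finset.sum_insert (by simp [mkLine_eq]), Finset.sum_insert (by simp [mkLine_eq]),
        Finset.sum_insert (by simp [mkLine_eq]), Finset.sum_singleton]
      simp only [pol_mkP]
      simp [← sub_eq_add_neg, sub_eq_zero]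
    simp only [Set.mem_ofPred_eq, IsIntersectionPoint, hi, Finset.coe_insert, Finset.coe_singleton,
      Set.mem_insert_iff, Set.mem_singleton_iff, mkPoint_eq]
    by_cases h1 : a = 0 <;> by_cases h2 : b = 0 <;> by_cases h3 : c = 0 <;>
      by_cases h4 : a = b <;> by_cases h5 : a = c <;> by_cases h6 : b = c <;> simp_all <;> grind
  unfold nk
  rw [this, Set.ncard_coe_finset]
  rw [Finset.card_insert_of_notMem (by simp [mkPoint_eq]),
    Finset.card_insert_of_notMem (by simp [mkPoint_eq]), Finset.card_singleton]

lemma exists_frame (x y z : Module.Dual ℂ (Fin 3 → ℂ))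
    (h : ∀ v, x v = 0 → y v = 0 → z v = 0 → v = 0) :
    ∃ T : (Fin 3 → ℂ) ≃ₗ[ℂ] (Fin 3 → ℂ), ∀ v, T v 0 = x v ∧ T v 1 = y v ∧ T v 2 = z v := by
  let f : (Fin 3 → ℂ) →ₗ[ℂ] (Fin 3 → ℂ) := LinearMap.pi ![x, y, z]
  have hf : Function.Injective f := by
    rw [injective_iff_map_eq_zero]
    intro v hv
    have h0 := congrFun hv 0
    have h1 := congrFun hv 1
    have h2 := congrFun hv 2
    exact h v (by simpa [f] using h0) (by simpa [f] using h1) (by simpa [f] using h2)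
  refine ⟨LinearEquiv.ofInjectiveEndo f hf, fun v => ?_⟩
  simp [f]

lemma lineMap_eq (T : (Fin 3 → ℂ) ≃ₗ[ℂ] (Fin 3 → ℂ)) (φ : Module.Dual ℂ (Fin 3 → ℂ))
    (hφ : φ ≠ 0) {a b c : ℂ} (h : a ≠ 0 ∨ b ≠ 0 ∨ c ≠ 0)
    (hv : ∀ v, φ v = a * T v 0 + b * T v 1 + c * T v 2) :
    lineMap T (Projectivization.mk ℂ φ hφ) = mkLine a b c h := by
  unfold lineMap mkLine
  rw [Projectivization.map_mk]
  congr 1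
  refine LinearMap.ext fun v => ?_
  simp [hv, mkForm_apply]

lemma lineMap_repr (T : (Fin 3 → ℂ) ≃ₗ[ℂ] (Fin 3 → ℂ)) (L : ProjLine) :
    ∃ a b c h φ hφ, L = Projectivization.mk ℂ φ hφ ∧ lineMap T L = mkLine a b c h ∧
      ∀ v, φ v = a * T v 0 + b * T v 1 + c * T v 2 := by
  induction L using Projectivization.ind with
  | h φ hφ =>
  have h1 := mkForm_surj (φ ∘ₗ (T.symm : (Fin 3 → ℂ) →ₗ[ℂ] (Fin 3 → ℂ)))
  set a := (φ ∘ₗ (T.symm : (Fin 3 → ℂ) →ₗ[ℂ] (Fin 3 → ℂ))) (Pi.single 0 1)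
  set b := (φ ∘ₗ (T.symm : (Fin 3 → ℂ) →ₗ[ℂ] (Fin 3 → ℂ))) (Pi.single 1 1)
  set c := (φ ∘ₗ (T.symm : (Fin 3 → ℂ) →ₗ[ℂ] (Fin 3 → ℂ))) (Pi.single 2 1)
  have hv : ∀ v, φ v = a * T v 0 + b * T v 1 + c * T v 2 := by
    intro v
    have := LinearMap.congr_fun h1 (T v)
    rw [mkForm_apply] at this
    simpa using this
  have h : a ≠ 0 ∨ b ≠ 0 ∨ c ≠ 0 := by
    by_contra! hc
    apply hφ
    refine LinearMap.ext fun v => ?_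
    rw [hv, hc.1, hc.2.1, hc.2.2]
    simp
  exact ⟨a, b, c, h, φ, hφ, rfl, lineMap_eq T φ hφ h hv, hv⟩

lemma normal_form {p : ProjPoint} {L1 L2 L3 M1 M2 : ProjLine}
    (h1 : PointOnLine p L1) (h2 : PointOnLine p L2) (h3 : PointOnLine p L3)
    (h12 : L1 ≠ L2) (h13 : L1 ≠ L3) (h23 : L2 ≠ L3)
    (k1 : ¬ PointOnLine p M1) (k2 : ¬ PointOnLine p M2) (k12 : M1 ≠ M2)
    (hc : Conc M1 M2 L1) :
    ∃ T, lineMap T L1 = mkLine 1 0 0 (by simp) ∧ lineMap T L2 = mkLine 0 1 0 (by simp) ∧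
      lineMap T M1 = mkLine 0 0 1 (by simp) ∧ lineMap T L3 = mkLine 1 (-1) 0 (by simp) ∧
      lineMap T M2 = mkLine 1 0 (-1) (by simp) := by
  have hind : ∀ v, L1.rep v = 0 → L2.rep v = 0 → M1.rep v = 0 → v = 0 := by
    intro v a1 a2 a3
    by_contra hv
    have e : ∀ L : ProjLine, L.rep v = 0 → PointOnLine (Projectivization.mk ℂ v hv) L := by
      intro L hL
      rw [← L.mk_rep, pol_mk]
      exact hL
    have := meet_unique h12 h1 h2 (e _ a1) (e _ a2)
    apply k1
    rw [this]
    exact e _ a3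
  obtain ⟨T, hT⟩ := exists_frame _ _ _ hind
  have t1 : lineMap T L1 = mkLine 1 0 0 (by simp) := by
    rw [← L1.mk_rep]; apply lineMap_eq; intro v; simp [hT]
  have t2 : lineMap T L2 = mkLine 0 1 0 (by simp) := by
    rw [← L2.mk_rep]; apply lineMap_eq; intro v; simp [hT]
  have t3 : lineMap T M1 = mkLine 0 0 1 (by simp) := by
    rw [← M1.mk_rep]; apply lineMap_eq; intro v; simp [hT]
  obtain ⟨a, b, c, h, φ, hφ, e3, t4, hv⟩ := lineMap_repr T L3
  obtain ⟨a', b', c', h', φ', hφ', e4, t5, hv'⟩ := lineMap_repr T M2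
  have c1 : Conc L1 L2 L3 := ⟨p, h1, h2, h3⟩
  replace c1 := conc_map T c1
  rw [t1, t2, t4] at c1
  replace c1 := conc_det _ _ _ c1
  have c2 := conc_map T hc
  rw [t3, t5, t1] at c2
  replace c2 := conc_det _ _ _ c2
  have d1 := (lineMap_inj T).ne h13
  have d2 := (lineMap_inj T).ne h23
  rw [t1, t4, Ne, mkLine_eq] at d1
  rw [t2, t4, Ne, mkLine_eq] at d2
  have d3 := (lineMap_inj T).ne k12
  rw [t3, t5, Ne, mkLine_eq] at d3
  have d4 : L1 ≠ M2 := by rintro rfl; exact k2 h1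
  replace d4 := (lineMap_inj T).ne d4
  rw [t1, t5, Ne, mkLine_eq] at d4
  obtain rfl : c = 0 := by simpa using c1
  obtain rfl : b' = 0 := by simpa using c2
  have ha : a ≠ 0 := by rintro rfl; simp at d2
  have hb : b ≠ 0 := by rintro rfl; simp at d1
  have ha' : a' ≠ 0 := by rintro rfl; simp at d3
  have hc' : c' ≠ 0 := by rintro rfl; simp at d4
  have hind' : ∀ v, L1.rep v = 0 → (-(b / a) • L2.rep) v = 0 → (-(c' / a') • M1.rep) v = 0 →
      v = 0 := by
    intro v a1 a2 a3
    refine hind v a1 ?_ ?_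
    · simpa [ha, hb] using a2
    · simpa [ha', hc'] using a3
  obtain ⟨S, hS⟩ := exists_frame _ _ _ hind'
  refine ⟨S, ?_, ?_, ?_, ?_, ?_⟩
  · rw [← L1.mk_rep]; apply lineMap_eq; intro v; simp [hS]
  · rw [← L2.mk_rep, lineMap_eq S _ _ (a := 0) (b := -(a / b)) (c := 0), mkLine_eq]
    · simp
    · simp [ha, hb]
    · intro v; simp [hS]; field_simp
  · rw [← M1.mk_rep, lineMap_eq S _ _ (a := 0) (b := 0) (c := -(a' / c')), mkLine_eq]
    · simp
    · simp [ha', hc']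
    · intro v; simp [hS]; field_simp
  · rw [e3, lineMap_eq S _ _ (a := a) (b := -a) (c := 0), mkLine_eq]
    · simp
    · simp [ha]
    · intro v; rw [hv]; simp [hS, hT]; field_simp
  · rw [e4, lineMap_eq S _ _ (a := a') (b := 0) (c := -a'), mkLine_eq]
    · simp
    · simp [ha']
    · intro v; rw [hv']; simp [hS, hT]; field_simp

/-- The lines of `A` through `p`. -/
def thru (A : Finset ProjLine) (p : ProjPoint) : Finset ProjLine :=
  A.filter fun L => PointOnLine p L

lemma mem_thru {A : Finset ProjLine} {p : ProjPoint} {L : ProjLine} :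
    L ∈ thru A p ↔ L ∈ A ∧ PointOnLine p L := by
  simp [thru]

lemma mult_thru (A : Finset ProjLine) (p : ProjPoint) : mult A p = (thru A p).card := by
  rw [mult_eq, ← Finset.card_filter]; rfl

lemma isInt_of {A : Finset ProjLine} {p : ProjPoint} {L M : ProjLine} (hL : L ∈ A) (hM : M ∈ A)
    (h1 : PointOnLine p L) (h2 : PointOnLine p M) (h : L ≠ M) : IsIntersectionPoint A p := by
  unfold IsIntersectionPoint
  rw [mult_thru]
  exact Finset.one_lt_card.2 ⟨L, mem_thru.2 ⟨hL, h1⟩, M, mem_thru.2 ⟨hM, h2⟩, h⟩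

/-- A point whose multiplicity is at least that of a modular triple point is modular. -/
lemma modular_of_three {A : Finset ProjLine} {p q : ProjPoint} (hp : IsModular A p)
    (h3 : mult A p = 3) (hq : 3 ≤ mult A q) : IsModular A q := by
  by_cases hqp : q = p
  · rwa [hqp]
  have hqi : IsIntersectionPoint A q := by unfold IsIntersectionPoint; omega
  refine ⟨hqi, fun r hr hrq => ?_⟩
  by_contra hno
  push Not at hno
  obtain ⟨L1, hL1, hpL1, hqL1⟩ := hp.2 q hqi hqp
  have hrp : r ≠ p := by
    rintro rfl
    exact hno L1 hL1 hqL1 hpL1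
  obtain ⟨L2, hL2, hpL2, hrL2⟩ := hp.2 r hr hrp
  have hrL1 := hno L1 hL1 hqL1
  have hL12 : L1 ≠ L2 := by rintro rfl; exact hrL1 hrL2
  obtain ⟨M, hMm, hML2⟩ : ∃ M ∈ thru A r, M ≠ L2 := by
    apply Finset.exists_mem_ne
    rw [← mult_thru]; exact hr
  obtain ⟨hM, hrM⟩ := mem_thru.1 hMm
  have hpM : ¬ PointOnLine p M := fun hh => hrp (meet_unique hML2 hrM hrL2 hh hpL2)
  have hqM : ¬ PointOnLine q M := fun hh => hno M hM hh hrM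
  have hcard : 1 < ((thru A q).erase L1).card := by
    rw [Finset.card_erase_of_mem (mem_thru.2 ⟨hL1, hqL1⟩), ← mult_thru]; omega
  obtain ⟨N1, hN1, N2, hN2, hN12⟩ := Finset.one_lt_card.1 hcard
  rw [Finset.mem_erase, mem_thru] at hN1 hN2
  have key : ∀ N, N ≠ L1 ∧ N ∈ A ∧ PointOnLine q N → ∃ s K, PointOnLine s M ∧ PointOnLine s N ∧
      PointOnLine s K ∧ K ∈ ((thru A p).erase L1).erase L2 := by
    rintro N ⟨hNL, hN, hqN⟩
    obtain ⟨s, hsM, hsN⟩ := exists_meet M N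
    have hMN : M ≠ N := by rintro rfl; exact hqM hqN
    have hsp : s ≠ p := by rintro rfl; exact hpM hsM
    obtain ⟨K, hK, hpK, hsK⟩ := hp.2 s (isInt_of hM hN hsM hsN hMN) hsp
    refine ⟨s, K, hsM, hsN, hsK, ?_⟩
    rw [Finset.mem_erase, Finset.mem_erase, mem_thru]
    refine ⟨?_, ?_, hK, hpK⟩
    · rintro rfl
      have := meet_unique hML2 hsM hsK hrM hrL2
      subst this
      exact hno N hN hqN hsN
    · rintro rfl
      have := meet_unique hNL hsN hsK hqN hqL1
      subst this
      exact hqM hsM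
  obtain ⟨s1, K1, a1, a2, a3, a4⟩ := key N1 hN1
  obtain ⟨s2, K2, b1, b2, b3, b4⟩ := key N2 hN2
  have hle : (((thru A p).erase L1).erase L2).card ≤ 1 := by
    rw [Finset.card_erase_of_mem, Finset.card_erase_of_mem (mem_thru.2 ⟨hL1, hpL1⟩),
      ← mult_thru, h3]
    exact Finset.mem_erase.2 ⟨hL12.symm, mem_thru.2 ⟨hL2, hpL2⟩⟩
  have hK : K1 = K2 := Finset.card_le_one.1 hle _ a4 _ b4
  subst hK
  rw [Finset.mem_erase, Finset.mem_erase, mem_thru] at a4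
  have hKM : K1 ≠ M := by rintro rfl; exact hpM a4.2.2.2
  have hs := meet_unique hKM a3 a1 b3 b1
  subst hs
  have := meet_unique hN12 a2 b2 hN1.2.2 hN2.2.2
  subst this
  exact hqM a1

lemma conc_symm {L M N : ProjLine} (h : Conc L M N) : Conc M L N := by
  obtain ⟨q, a, b, c⟩ := h
  exact ⟨q, b, a, c⟩

lemma conc_rot {L M N : ProjLine} (h : Conc L M N) : Conc M N L := by
  obtain ⟨q, a, b, c⟩ := h
  exact ⟨q, b, c, a⟩

lemma equiv_card {A B : Finset ProjLine} (h : ProjEquiv A B) : A.card = B.card := by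
  obtain ⟨T, hT⟩ := h
  rw [← Set.ncard_coe_finset, ← Set.ncard_coe_finset, ← hT,
    Set.ncard_image_of_injective _ (lineMap_inj T)]

lemma card_arrB : arrB.card = 5 := by
  unfold arrB
  rw [Finset.card_insert_of_notMem (by simp [mkLine_eq]),
    Finset.card_insert_of_notMem (by simp [mkLine_eq]),
    Finset.card_insert_of_notMem (by simp [mkLine_eq]),
    Finset.card_insert_of_notMem (by simp [mkLine_eq]), Finset.card_singleton]

lemma card_mono : (monomialArr 3).card = 6 := by
  rw [monomialArr_three]
  rw [Finset.card_insert_of_notMem (by simp [mkLine_eq]),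
    Finset.card_insert_of_notMem (by simp [mkLine_eq]),
    Finset.card_insert_of_notMem (by simp [mkLine_eq]),
    Finset.card_insert_of_notMem (by simp [mkLine_eq]),
    Finset.card_insert_of_notMem (by simp [mkLine_eq]), Finset.card_singleton]

lemma classification_aux (A : Finset ProjLine)
    (h : IsHomogSS A 3) (hpencil : ¬ IsPencil A) :
    ProjEquiv A (monomialArr 3) ∨ ProjEquiv A arrB := by
  obtain ⟨⟨p, hp⟩, hom⟩ := h
  have hp3 := hom p hp
  -- two lines off `p` meet on a line through `p`
  have H1 : ∀ M M', M ∈ A → M' ∈ A → ¬ PointOnLine p M → M ≠ M' →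
      ∃ L ∈ thru A p, Conc M M' L := by
    intro M M' hM hM' hpM hne
    obtain ⟨s, hsM, hsN⟩ := exists_meet M M'
    have hsp : s ≠ p := by rintro rfl; exact hpM hsM
    obtain ⟨K, hK, hpK, hsK⟩ := hp.2 s (isInt_of hM hM' hsM hsN hne) hsp
    exact ⟨K, mem_thru.2 ⟨hK, hpK⟩, s, hsM, hsN, hsK⟩
  have H2 : ∀ L M M' M'', L ∈ thru A p → M ∈ A → M' ∈ A → M'' ∈ A → ¬ PointOnLine p M →
      ¬ PointOnLine p M' → ¬ PointOnLine p M'' → M ≠ M' → M ≠ M'' → M' ≠ M'' →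
      Conc M M' L → Conc M M'' L → False := by
    intro L M M' M'' hL hM hM' hM'' k k' k'' n1 n2 n3 c1 c2
    obtain ⟨q, a1, a2, a3⟩ := c1
    obtain ⟨q', b1, b2, b3⟩ := c2
    obtain ⟨hLA, hpL⟩ := mem_thru.1 hL
    have e : ∀ N, ¬ PointOnLine p N → L ≠ N := by rintro N hN rfl; exact hN hpL
    have hq := meet_unique (e _ k) a3 a1 b3 b1
    subst hq
    have hsub : ({L, M, M', M''} : Finset ProjLine) ⊆ thru A q := by
      intro N hN
      simp only [Finset.mem_insert, Finset.mem_singleton] at hN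
      rw [mem_thru]
      rcases hN with rfl | rfl | rfl | rfl <;> exact ⟨by assumption, by assumption⟩
    have hc := Finset.card_le_card hsub
    rw [Finset.card_insert_of_notMem (by simp [e _ k, e _ k', e _ k'']),
      Finset.card_insert_of_notMem (by simp [n1, n2]),
      Finset.card_insert_of_notMem (by simp [n3]), Finset.card_singleton, ← mult_thru] at hc
    have := hom q (modular_of_three hp hp3 (by omega))
    omega
  -- a line off `p`
  obtain ⟨M1, hM1, k1⟩ : ∃ M ∈ A, ¬ PointOnLine p M := by
    by_contra! hc
    exact hpencil ⟨p, hc⟩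
  -- a second one
  obtain ⟨M2, hM2, k2, n12⟩ : ∃ M ∈ A, ¬ PointOnLine p M ∧ M1 ≠ M := by
    by_contra! hc
    obtain ⟨L, hL⟩ : (thru A p).Nonempty := by
      rw [← Finset.card_pos, ← mult_thru]; omega
    obtain ⟨hLA, hpL⟩ := mem_thru.1 hL
    obtain ⟨q, hqL, hqM⟩ := exists_meet L M1
    have hLM : L ≠ M1 := by rintro rfl; exact k1 hpL
    have hqp : p ≠ q := by rintro rfl; exact k1 hqM
    have hmod : IsModular A q := by
      refine ⟨isInt_of hLA hM1 hqL hqM hLM, fun r hr hrq => ?_⟩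
      by_cases hrM : PointOnLine r M1
      · exact ⟨M1, hM1, hqM, hrM⟩
      · refine ⟨L, hLA, hqL, ?_⟩
        unfold IsIntersectionPoint at hr
        rw [mult_thru] at hr
        obtain ⟨N1, hN1, N2, hN2, hne⟩ := Finset.one_lt_card.1 hr
        rw [mem_thru] at hN1 hN2
        have e : ∀ N, N ∈ A ∧ PointOnLine r N → PointOnLine p N := by
          rintro N ⟨hN, hrN⟩
          by_contra hpN
          rw [hc N hN hpN] at hrM
          exact hrM hrN
        have := meet_unique hne hN1.2 hN2.2 (e _ hN1) (e _ hN2)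
        rw [this]; exact hpL
    have h3 := hom q hmod
    rw [mult_thru] at h3
    have hsub : thru A q ⊆ {L, M1} := by
      intro N hN
      rw [mem_thru] at hN
      simp only [Finset.mem_insert, Finset.mem_singleton]
      by_cases hpN : PointOnLine p N
      · left
        by_contra hNL
        exact hqp (meet_unique hNL hpN hpL hN.2 hqL)
      · right
        exact (hc N hN.1 hpN).symm
    have := Finset.card_le_card hsub
    have := Finset.card_le_two (a := L) (b := M1)
    omega
  obtain ⟨L1, hL1, c12⟩ := H1 M1 M2 hM1 hM2 k1 n12
  rw [mult_thru] at hp3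
  -- completing a pair of lines through `p` to all three
  have third : ∀ L ∈ thru A p, ∀ L' ∈ thru A p, L ≠ L' → ∃ L'', L'' ∈ thru A p ∧ L ≠ L'' ∧
      L' ≠ L'' ∧ ∀ N ∈ thru A p, N = L ∨ N = L' ∨ N = L'' := by
    intro L hL L' hL' hne
    have : (((thru A p).erase L).erase L').card = 1 := by
      rw [Finset.card_erase_of_mem (Finset.mem_erase.2 ⟨hne.symm, hL'⟩),
        Finset.card_erase_of_mem hL, hp3]
    obtain ⟨L'', h''⟩ := Finset.card_eq_one.1 this
    have hm : ∀ N, N ∈ ((thru A p).erase L).erase L' ↔ N = L'' := by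
      intro N; rw [h'', Finset.mem_singleton]
    simp only [Finset.mem_erase] at hm
    obtain ⟨u1, u2, u3⟩ := (hm L'').2 rfl
    refine ⟨L'', u3, Ne.symm u2, Ne.symm u1, fun N hN => ?_⟩
    by_contra! hcon
    exact hcon.2.2 ((hm N).1 ⟨hcon.2.1, hcon.1, hN⟩)
  have hP : ∀ {N}, N ∈ thru A p → PointOnLine p N := fun hN => (mem_thru.1 hN).2
  have hA : ∀ {N}, N ∈ thru A p → N ∈ A := fun hN => (mem_thru.1 hN).1
  by_cases hK : ∃ M3 ∈ A, ¬ PointOnLine p M3 ∧ M1 ≠ M3 ∧ M2 ≠ M3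
  · left
    obtain ⟨M3, hM3, k3, n13, n23⟩ := hK
    obtain ⟨L2, hL2, c13⟩ := H1 M1 M3 hM1 hM3 k1 n13
    have l12 : L1 ≠ L2 := by
      rintro rfl
      exact H2 _ _ _ _ hL1 hM1 hM2 hM3 k1 k2 k3 n12 n13 n23 c12 c13
    obtain ⟨L3, hL3, l13, l23, hall⟩ := third L1 hL1 L2 hL2 l12
    have c23 : Conc M2 M3 L3 := by
      obtain ⟨L, hL, hc⟩ := H1 M2 M3 hM2 hM3 k2 n23
      rcases hall L hL with rfl | rfl | rfl
      · exact (H2 _ _ _ _ hL hM2 hM1 hM3 k2 k1 k3 n12.symm n23 n13 (conc_symm c12) hc).elim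
      · exact (H2 _ _ _ _ hL hM3 hM1 hM2 k3 k1 k2 n13.symm n23.symm n12 (conc_symm c13)
          (conc_symm hc)).elim
      · exact hc
    obtain ⟨T, t1, t2, t3, t4, t5⟩ := normal_form (hP hL1) (hP hL2) (hP hL3) l12 l13 l23 k1 k2
      n12 c12
    have t6 : lineMap T M3 = mkLine 0 1 (-1) (by simp) := by
      obtain ⟨a, b, c, h, hl⟩ := exists_mkLine (lineMap T M3)
      have e1 := conc_map T c13
      have e2 := conc_map T c23
      rw [t3, hl, t2] at e1
      rw [t5, hl, t4] at e2
      have f1 := conc_det _ _ _ e1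
      have f2 := conc_det _ _ _ e2
      rw [hl, mkLine_eq]
      grind
    have hA6 : ∀ N ∈ A, N = L1 ∨ N = L2 ∨ N = L3 ∨ N = M1 ∨ N = M2 ∨ N = M3 := by
      intro N hN
      by_cases hpN : PointOnLine p N
      · have := hall N (mem_thru.2 ⟨hN, hpN⟩)
        tauto
      by_contra! hcon
      obtain ⟨-, -, -, m1, m2, m3⟩ := hcon
      have d1 : Conc M1 N L3 := by
        obtain ⟨L, hL, hc⟩ := H1 M1 N hM1 hN k1 m1.symm
        rcases hall L hL with rfl | rfl | rfl
        · exact (H2 _ _ _ _ hL hM1 hM2 hN k1 k2 hpN n12 m1.symm m2.symm c12 hc).elim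
        · exact (H2 _ _ _ _ hL hM1 hM3 hN k1 k3 hpN n13 m1.symm m3.symm c13 hc).elim
        · exact hc
      have d2 : Conc M2 N L2 := by
        obtain ⟨L, hL, hc⟩ := H1 M2 N hM2 hN k2 m2.symm
        rcases hall L hL with rfl | rfl | rfl
        · exact (H2 _ _ _ _ hL hM2 hM1 hN k2 k1 hpN n12.symm m2.symm m1.symm
            (conc_symm c12) hc).elim
        · exact hc
        · exact (H2 _ _ _ _ hL hM2 hM3 hN k2 k3 hpN n23 m2.symm m3.symm c23 hc).elim
      have d3 : Conc M3 N L1 := by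
        obtain ⟨L, hL, hc⟩ := H1 M3 N hM3 hN k3 m3.symm
        rcases hall L hL with rfl | rfl | rfl
        · exact hc
        · exact (H2 _ _ _ _ hL hM3 hM1 hN k3 k1 hpN n13.symm m3.symm m1.symm
            (conc_symm c13) hc).elim
        · exact (H2 _ _ _ _ hL hM3 hM2 hN k3 k2 hpN n23.symm m3.symm m2.symm
            (conc_symm c23) hc).elim
      obtain ⟨a, b, c, h, hl⟩ := exists_mkLine (lineMap T N)
      have e1 := conc_map T d1
      have e2 := conc_map T d2
      have e3 := conc_map T d3
      rw [t3, hl, t4] at e1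
      rw [t5, hl, t2] at e2
      rw [t6, hl, t1] at e3
      have f1 := conc_det _ _ _ e1
      have f2 := conc_det _ _ _ e2
      have f3 := conc_det _ _ _ e3
      have ha : a = 0 := by grind
      have hb : b = 0 := by grind
      have hc : c = 0 := by grind
      simp [ha, hb, hc] at h
    refine ⟨T, ?_⟩
    have : A = {L1, L2, M1, L3, M2, M3} := by
      ext N
      simp only [Finset.mem_insert, Finset.mem_singleton]
      constructor
      · intro hN
        have := hA6 N hN
        tauto
      · rintro (rfl | rfl | rfl | rfl | rfl | rfl)
        exacts [hA hL1, hA hL2, hM1, hA hL3, hM2, hM3]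
    rw [this, monomialArr_three]
    simp only [Finset.coe_insert, Finset.coe_singleton, Set.image_insert_eq, Set.image_singleton,
      t1, t2, t3, t4, t5, t6]
  · right
    push Not at hK
    obtain ⟨L2, hL2, l12⟩ : ∃ L ∈ thru A p, L ≠ L1 := by
      apply Finset.exists_mem_ne
      omega
    obtain ⟨L3, hL3, l13, l23, hall⟩ := third L1 hL1 L2 hL2 l12.symm
    obtain ⟨T, t1, t2, t3, t4, t5⟩ := normal_form (hP hL1) (hP hL2) (hP hL3) l12.symm l13 l23 k1
      k2 n12 c12
    refine ⟨T, ?_⟩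
    have : A = {L1, L2, M1, L3, M2} := by
      ext N
      simp only [Finset.mem_insert, Finset.mem_singleton]
      constructor
      · intro hN
        by_cases hpN : PointOnLine p N
        · have := hall N (mem_thru.2 ⟨hN, hpN⟩)
          tauto
        · by_contra! hcon
          exact hcon.2.2.2.2 (hK N hN hpN hcon.2.2.1.symm).symm
      · rintro (rfl | rfl | rfl | rfl | rfl)
        exacts [hA hL1, hA hL2, hM1, hA hL3, hM2]
    rw [this, arrB]
    simp only [Finset.coe_insert, Finset.coe_singleton, Set.image_insert_eq, Set.image_singleton,
      t1, t2, t3, t4, t5]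

/-- A `3`-homogeneous supersolvable line arrangement `A`, not a
pencil, either has `6` lines and is projectively equivalent to the full monomial
arrangement `A(1,1,3)` (which has `n₂ = 3`), or has `5` lines and is projectively
equivalent to `B : xyz(x-y)(x-z) = 0` (which has `n₂ = 4`); in both cases
`n₂(A) ≥ |A|/2`. -/
theorem three_homogeneous_classification (A : Finset ProjLine)
    (h : IsHomogSS A 3) (hpencil : ¬ IsPencil A) :
    ((A.card = 6 ∧ ProjEquiv A (monomialArr 3) ∧ nk (monomialArr 3) 2 = 3) ∨
      (A.card = 5 ∧ ProjEquiv A arrB ∧ nk arrB 2 = 4)) ∧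
    (A.card : ℝ) / 2 ≤ (nk A 2 : ℝ) := by
  rcases classification_aux A h hpencil with he | he
  · have hc := (equiv_card he).trans card_mono
    refine ⟨Or.inl ⟨hc, he, nk_mono⟩, ?_⟩
    rw [nk_equiv he, nk_mono, hc]
    norm_num
  · have hc := (equiv_card he).trans card_arrB
    refine ⟨Or.inr ⟨hc, he, nk_arrB⟩, ?_⟩
    rw [nk_equiv he, nk_arrB, hc]
    norm_num

end
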